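/- arXiv:2505.22607 — 2 statements merged into one kernel-verified Lean document; each statement's English description precedes it below -/
import Mathlib

section
/- Let N ≥ 1. For every F : ℝ^N → ℂ smooth on ℝ^N \ {0} and every x ≠ 0, the differential operators 2∑_{j=1}^N x_j ∂_j + (N−2) and ‖x‖²Δ commute: (2∑_j x_j ∂_j + (N−2)) applied to the function y ↦ ‖y‖²(ΔF)(y), evaluated at x, equals ‖x‖²·Δ( y ↦ 2∑_j y_j ∂_jF(y) + (N−2)F(y) ) evaluated at x. Consequently the space g₀ spanned over ℝ by 2∑_j x_j ∂_j + (N−2), i (multiplication by i), and i‖x‖²Δ is a three-dimensional commutative Lie algebra of differential operators on ℝ^N \ {0}. -/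
/-- The Laplacian of a function on Euclidean space: the sum of second partial
derivatives along the standard orthonormal basis. -/
noncomputable def laplacian {N : ℕ} (G : EuclideanSpace ℝ (Fin N) → ℂ)
    (x : EuclideanSpace ℝ (Fin N)) : ℂ :=
  ∑ j : Fin N,
    fderiv ℝ (fun y => fderiv ℝ G y (EuclideanSpace.single j 1)) x
      (EuclideanSpace.single j 1)

/-- The operator `2 ∑ xⱼ ∂ⱼ + (N - 2)`. -/
noncomputable def opA {N : ℕ} (F : EuclideanSpace ℝ (Fin N) → ℂ) :
    EuclideanSpace ℝ (Fin N) → ℂ :=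
  fun x => 2 * fderiv ℝ F x x + ((N : ℂ) - 2) * F x

/-- The operator `‖x‖² Δ`. -/
noncomputable def opL {N : ℕ} (F : EuclideanSpace ℝ (Fin N) → ℂ) :
    EuclideanSpace ℝ (Fin N) → ℂ :=
  fun x => (‖x‖ : ℂ) ^ 2 * laplacian F x

open scoped ContDiff Topology

section EulerOperator

variable {E : Type*} [NormedAddCommGroup E] [NormedSpace ℝ E]

theorem ContDiffAt.fderiv_apply_const {F : E → ℂ} {x : E} (hF : ContDiffAt ℝ ∞ F x) (v : E) :
    ContDiffAt ℝ ∞ (fun y => fderiv ℝ F y v) x :=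
  (hF.fderiv_right (m := ∞) (by simp)).clm_apply contDiffAt_const

theorem ContDiffAt.fderiv_apply_self {F : E → ℂ} {x : E} (hF : ContDiffAt ℝ ∞ F x) :
    ContDiffAt ℝ ∞ (fun y => fderiv ℝ F y y) x :=
  (hF.fderiv_right (m := ∞) (by simp)).clm_apply contDiffAt_id

/-- The commutator of a directional derivative with the Euler operator `F ↦ (y ↦ F'(y) y)` is the
directional derivative itself. -/
theorem fderiv_fderiv_apply_self {F : E → ℂ} {x : E} (hF : ContDiffAt ℝ ∞ F x) (v : E) :
    fderiv ℝ (fun y => fderiv ℝ F y y) x v =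
      fderiv ℝ (fun y => fderiv ℝ F y v) x x + fderiv ℝ F x v := by
  have hd : DifferentiableAt ℝ (fderiv ℝ F) x :=
    (hF.fderiv_right (m := ∞) (by simp)).differentiableAt (by simp)
  have hsymm : fderiv ℝ (fderiv ℝ F) x v x = fderiv ℝ (fderiv ℝ F) x x v :=
    hF.isSymmSndFDerivAt (by simpa using ENat.LEInfty.out) v x
  have hself := hd.hasFDerivAt.clm_apply (hasFDerivAt_id x)
  have hconst := hd.hasFDerivAt.clm_apply (hasFDerivAt_const v x)
  simp only [id] at hself
  rw [hself.fderiv, hconst.fderiv]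
  simp [hsymm, add_comm]

theorem fderiv_fderiv_fderiv_apply_self {F : E → ℂ} {x : E} (hF : ContDiffAt ℝ ∞ F x) (v : E)
    (hF' : ∀ᶠ y in 𝓝 x, ContDiffAt ℝ ∞ F y) :
    fderiv ℝ (fun z => fderiv ℝ (fun y => fderiv ℝ F y y) z v) x v =
      fderiv ℝ (fun z => fderiv ℝ (fun y => fderiv ℝ F y v) z v) x x +
        2 * fderiv ℝ (fun y => fderiv ℝ F y v) x v := by
  have heq : (fun z => fderiv ℝ (fun y => fderiv ℝ F y y) z v) =ᶠ[𝓝 x]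
      fun z => fderiv ℝ (fun y => fderiv ℝ F y v) z z + fderiv ℝ F z v := by
    filter_upwards [hF'] with z hz using fderiv_fderiv_apply_self hz v
  have hv := hF.fderiv_apply_const v
  rw [heq.fderiv_eq, fderiv_fun_add (hv.fderiv_apply_self.differentiableAt (by simp))
    (hv.differentiableAt (by simp)), add_apply, fderiv_fderiv_apply_self hv v]
  ring

end EulerOperator

section Laplacian

variable {N : ℕ} {F G : EuclideanSpace ℝ (Fin N) → ℂ} {x : EuclideanSpace ℝ (Fin N)}

theorem laplacian_fun_add (hF : ∀ᶠ y in 𝓝 x, ContDiffAt ℝ ∞ F y)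
    (hG : ∀ᶠ y in 𝓝 x, ContDiffAt ℝ ∞ G y) :
    laplacian (fun y => F y + G y) x = laplacian F x + laplacian G x := by
  simp only [laplacian, ← Finset.sum_add_distrib]
  refine Finset.sum_congr rfl fun j _ => ?_
  set v : EuclideanSpace ℝ (Fin N) := EuclideanSpace.single j 1
  have heq : (fun z => fderiv ℝ (fun y => F y + G y) z v) =ᶠ[𝓝 x]
      fun z => fderiv ℝ F z v + fderiv ℝ G z v := by
    filter_upwards [hF, hG] with z hz hz'
    rw [fderiv_fun_add (hz.differentiableAt (by simp)) (hz'.differentiableAt (by simp)), add_apply]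
  rw [heq.fderiv_eq, fderiv_fun_add
    ((hF.self_of_nhds.fderiv_apply_const v).differentiableAt (by simp))
    ((hG.self_of_nhds.fderiv_apply_const v).differentiableAt (by simp)), add_apply]

theorem laplacian_const_mul (c : ℂ) (hF : ∀ᶠ y in 𝓝 x, ContDiffAt ℝ ∞ F y) :
    laplacian (fun y => c * F y) x = c * laplacian F x := by
  simp only [laplacian, Finset.mul_sum]
  refine Finset.sum_congr rfl fun j _ => ?_
  set v : EuclideanSpace ℝ (Fin N) := EuclideanSpace.single j 1
  have heq : (fun z => fderiv ℝ (fun y => c * F y) z v) =ᶠ[𝓝 x]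
      fun z => c * fderiv ℝ F z v := by
    filter_upwards [hF] with z hz
    rw [fderiv_const_mul (hz.differentiableAt (by simp))]
    simp
  rw [heq.fderiv_eq, fderiv_const_mul
    ((hF.self_of_nhds.fderiv_apply_const v).differentiableAt (by simp))]
  simp

theorem ContDiffAt.laplacian (hF : ContDiffAt ℝ ∞ F x) : ContDiffAt ℝ ∞ (laplacian F) x := by
  unfold _root_.laplacian
  exact ContDiffAt.sum fun j _ => (hF.fderiv_apply_const _).fderiv_apply_const _

/-- The commutator of the Laplacian with the Euler operator is twice the Laplacian. -/
theorem laplacian_fderiv_apply_self (hF : ∀ᶠ y in 𝓝 x, ContDiffAt ℝ ∞ F y) :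
    laplacian (fun y => fderiv ℝ F y y) x = fderiv ℝ (laplacian F) x x + 2 * laplacian F x := by
  have hx := hF.self_of_nhds
  have hsum : fderiv ℝ (laplacian F) x x = ∑ j : Fin N,
      fderiv ℝ (fun z => fderiv ℝ (fun y => fderiv ℝ F y (EuclideanSpace.single j 1)) z
        (EuclideanSpace.single j 1)) x x := by
    unfold laplacian
    rw [fderiv_fun_sum fun j _ => ((hx.fderiv_apply_const _).fderiv_apply_const _).differentiableAt
      (by simp)]
    simp
  rw [hsum]
  simp only [laplacian, Finset.mul_sum, ← Finset.sum_add_distrib]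
  exact Finset.sum_congr rfl fun j _ => fderiv_fderiv_fderiv_apply_self hx _ hF

theorem fderiv_norm_sq_mul_apply_self (hG : DifferentiableAt ℝ G x) :
    fderiv ℝ (fun y => (‖y‖ : ℂ) ^ 2 * G y) x x =
      (‖x‖ : ℂ) ^ 2 * (2 * G x + fderiv ℝ G x x) := by
  have hn : HasFDerivAt (fun y : EuclideanSpace ℝ (Fin N) => (‖y‖ : ℂ) ^ 2)
      (Complex.ofRealCLM.comp (2 • innerSL ℝ x)) x := by
    simpa [Function.comp_def] using
      Complex.ofRealCLM.hasFDerivAt.comp x (hasStrictFDerivAt_norm_sq x).hasFDerivAt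
  rw [(hn.fun_mul hG.hasFDerivAt).fderiv]
  simp
  ring

end Laplacian

theorem stmt4 (N : ℕ) (hN : 1 ≤ N)
    (F : EuclideanSpace ℝ (Fin N) → ℂ)
    (hF : ContDiffOn ℝ (⊤ : ℕ∞) F {(0 : EuclideanSpace ℝ (Fin N))}ᶜ) :
    ∀ x : EuclideanSpace ℝ (Fin N), x ≠ 0 →
      opA (opL F) x = opL (opA F) x := by
  intro x hx
  have hev : ∀ᶠ y in 𝓝 x, ContDiffAt ℝ ∞ F y := by
    filter_upwards [isOpen_compl_singleton.mem_nhds hx] with y hy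
    exact hF.contDiffAt (isOpen_compl_singleton.mem_nhds hy)
  have hevD : ∀ᶠ y in 𝓝 x, ContDiffAt ℝ ∞ (fun y => fderiv ℝ F y y) y :=
    hev.mono fun y hy => hy.fderiv_apply_self
  unfold opA opL
  rw [fderiv_norm_sq_mul_apply_self (hev.self_of_nhds.laplacian.differentiableAt (by simp)),
    laplacian_fun_add (hevD.mono fun y hy => contDiffAt_const.mul hy)
      (hev.mono fun y hy => contDiffAt_const.mul hy),
    laplacian_const_mul _ hevD, laplacian_const_mul _ hev, laplacian_fderiv_apply_self hev]
  ring
end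

section
/- Let z ∈ ℂ with Re z > 0 and let θ ∈ (0, π). Then ∑_{m=0}^∞ (m+1)·exp(−z·(m+1)²)·U_m(cos θ) = −(1/(4π·sin θ))·jacobiTheta₂′( θ/(2π), i·z/π ), where U_m is the Chebyshev polynomial of the second kind (evaluated over ℝ, the value being regarded as a complex number) and the series converges absolutely. Equivalently, ∑_{m≥0} exp(−z(m+1)²)·C̃_m¹(cos θ) = −(1/(4π sin θ))·∂ϑ/∂v(θ/(2π), iz/π), which is the spherical-part sum in the closed-form integral kernel of exp(z‖x‖²Δ) for N = 4. -/
open Real Complex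

/-- The terms of index `n` and `-n` in the derivative of the theta series at the point
`(θ / (2π), iz / π)` combine to a real sine mode. -/
lemma jacobiTheta₂'_term_add_neg (n : ℤ) (z : ℂ) (θ : ℝ) :
    jacobiTheta₂'_term n ((θ : ℂ) / (2 * (π : ℂ))) (Complex.I * z / (π : ℂ)) +
      jacobiTheta₂'_term (-n) ((θ : ℂ) / (2 * (π : ℂ))) (Complex.I * z / (π : ℂ)) =
      -(4 * π) * (n * Complex.exp (-z * n ^ 2) * Complex.sin (n * θ)) := by
  have hπ : (π : ℂ) ≠ 0 := ofReal_ne_zero.mpr pi_ne_zero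
  have key (k : ℂ) : 2 * π * I * k * ((θ : ℂ) / (2 * (π : ℂ))) + π * I * k ^ 2 *
      (Complex.I * z / (π : ℂ)) = -z * k ^ 2 + k * θ * I := by
    field_simp
    linear_combination k ^ 2 * z * I_sq
  simp only [jacobiTheta₂'_term, jacobiTheta₂_term, key, Complex.exp_add, Complex.sin]
  push_cast
  simp only [neg_mul, neg_sq]
  ring

theorem stmt12 (z : ℂ) (hz : 0 < z.re) (θ : ℝ) (hθ : θ ∈ Set.Ioo 0 π) :
    Summable (fun m : ℕ =>
      ‖((m : ℂ) + 1) * Complex.exp (-z * ((m : ℂ) + 1) ^ 2) *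
        (((Polynomial.Chebyshev.U ℝ (m : ℤ)).eval (Real.cos θ) : ℝ) : ℂ)‖) ∧
    ∑' m : ℕ, ((m : ℂ) + 1) * Complex.exp (-z * ((m : ℂ) + 1) ^ 2) *
        (((Polynomial.Chebyshev.U ℝ (m : ℤ)).eval (Real.cos θ) : ℝ) : ℂ) =
      -(1 / (4 * (π : ℂ) * (Real.sin θ : ℂ))) *
        jacobiTheta₂' ((θ : ℂ) / (2 * (π : ℂ))) (Complex.I * z / (π : ℂ)) := by
  have hπ : (π : ℂ) ≠ 0 := ofReal_ne_zero.mpr pi_ne_zero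
  have hsin : (Real.sin θ : ℂ) ≠ 0 := ofReal_ne_zero.mpr (Real.sin_pos_of_mem_Ioo hθ).ne'
  have hτ : 0 < (Complex.I * z / (π : ℂ)).im := by
    rw [div_ofReal_im, I_mul_im]
    exact div_pos hz pi_pos
  have hpair := (hasSum_jacobiTheta₂'_term ((θ : ℂ) / (2 * (π : ℂ))) hτ).nat_add_neg
  rw [show jacobiTheta₂'_term 0 ((θ : ℂ) / (2 * (π : ℂ))) (Complex.I * z / (π : ℂ)) = 0 by
    simp [jacobiTheta₂'_term], add_zero] at hpair
  simp only [jacobiTheta₂'_term_add_neg] at hpair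
  have hshift := (hasSum_nat_add_iff' 1).mpr hpair
  rw [Finset.sum_range_one, Nat.cast_zero, Int.cast_zero, zero_mul, zero_mul, mul_zero,
    sub_zero] at hshift
  have hsum : HasSum (fun m : ℕ => ((m : ℂ) + 1) * Complex.exp (-z * ((m : ℂ) + 1) ^ 2) *
      (((Polynomial.Chebyshev.U ℝ (m : ℤ)).eval (Real.cos θ) : ℝ) : ℂ))
      (-(1 / (4 * (π : ℂ) * (Real.sin θ : ℂ))) *
        jacobiTheta₂' ((θ : ℂ) / (2 * (π : ℂ))) (Complex.I * z / (π : ℂ))) := by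
    refine HasSum.congr_fun
      (hshift.mul_left (-(1 / (4 * (π : ℂ) * (Real.sin θ : ℂ))))) fun m => ?_
    have hU := congrArg ((↑) : ℝ → ℂ) (Polynomial.Chebyshev.U_real_cos θ (m : ℤ))
    push_cast [-ofReal_cos, -ofReal_sin, -Polynomial.Chebyshev.complex_ofReal_eval_U] at hU ⊢
    rw [ofReal_sin ((m + 1) * θ)] at hU
    push_cast [-ofReal_cos, -ofReal_sin, -Polynomial.Chebyshev.complex_ofReal_eval_U] at hU
    rw [← hU]
    field_simp
  exact ⟨hsum.summable.norm, hsum.tsum_eq⟩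
end
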